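/- arXiv:1506.08047 — 6 statements merged into one kernel-verified Lean document; each statement's English description precedes it below -/
import Mathlib

section
/- Let K, C, m > 0 and γ ∈ (0,1]. Let θ be a continuous probability density on ℝ vanishing on (−∞,0), satisfying ∫_0^∞ y^{4+m} θ(y) dy ≤ K and the Hölder condition |θ(x) − θ(y)| ≤ C |x − y|^γ for all x, y ∈ ℝ. Set T_K = (2K)^{1/(4+m)} and Δ = (16 T_K C)^{−1/γ}. Then there exists a ∈ (0, T_K] such that θ(x) ≥ (1/16) (2K)^{−1/(4+m)} for every x ∈ [a, a + Δ]. -/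
open MeasureTheory Set
open scoped ENNReal Real

noncomputable section

/-- If a nonnegative function is bounded by `c` on `(0, T]`, vanishes on the negative half-line and
has `p`-th moment at most `K`, then its integral is at most `c * T + K / T ^ p`. -/
theorem lintegral_le_of_le_on_Ioc_of_moment {K T p c : ℝ} (hT : 0 < T) (hp : 0 ≤ p)
    (hc : 0 ≤ c) (hK : 0 ≤ K) {θ : ℝ → ℝ} (hnonneg : ∀ y, 0 ≤ θ y)
    (hvanish : ∀ x < (0 : ℝ), θ x = 0)
    (hmom : ∫⁻ y in Ioi (0 : ℝ), ENNReal.ofReal (y ^ p * θ y) ≤ ENNReal.ofReal K)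
    (hle : ∀ y ∈ Ioc 0 T, θ y ≤ c) :
    ∫⁻ y : ℝ, ENNReal.ofReal (θ y) ≤ ENNReal.ofReal (c * T + K / T ^ p) := by
  have hTp : 0 < T ^ p := Real.rpow_pos_of_pos hT p
  have hneg : ∫⁻ y in Iic (0 : ℝ), ENNReal.ofReal (θ y) = 0 := by
    rw [setLIntegral_congr (Iio_ae_eq_Iic (a := (0 : ℝ))).symm,
      setLIntegral_congr_fun (g := fun _ => 0) measurableSet_Iio
        (fun x hx => by simp [hvanish x hx])]
    simp
  have hmid : ∫⁻ y in Ioc 0 T, ENNReal.ofReal (θ y) ≤ ENNReal.ofReal (c * T) := by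
    calc ∫⁻ y in Ioc 0 T, ENNReal.ofReal (θ y)
        ≤ ∫⁻ _ in Ioc 0 T, ENNReal.ofReal c :=
          setLIntegral_mono' measurableSet_Ioc fun y hy => ENNReal.ofReal_le_ofReal (hle y hy)
      _ = ENNReal.ofReal (c * T) := by simp [ENNReal.ofReal_mul hc]
  have htail : ∫⁻ y in Ioi T, ENNReal.ofReal (θ y) ≤ ENNReal.ofReal (K / T ^ p) := by
    calc ∫⁻ y in Ioi T, ENNReal.ofReal (θ y)
        ≤ ∫⁻ y in Ioi T, ENNReal.ofReal (T ^ p)⁻¹ * ENNReal.ofReal (y ^ p * θ y) := by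
          refine setLIntegral_mono' measurableSet_Ioi fun y hy => ?_
          rw [← ENNReal.ofReal_mul (by positivity)]
          refine ENNReal.ofReal_le_ofReal ?_
          rw [inv_mul_eq_div, le_div_iff₀ hTp, mul_comm]
          exact mul_le_mul_of_nonneg_right
            (Real.rpow_le_rpow hT.le (le_of_lt hy) hp) (hnonneg y)
      _ = ENNReal.ofReal (T ^ p)⁻¹ * ∫⁻ y in Ioi T, ENNReal.ofReal (y ^ p * θ y) :=
          lintegral_const_mul' _ _ ENNReal.ofReal_ne_top
      _ ≤ ENNReal.ofReal (T ^ p)⁻¹ * ENNReal.ofReal K := by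
          gcongr
          exact (lintegral_mono_set (Ioi_subset_Ioi hT.le)).trans hmom
      _ = ENNReal.ofReal (K / T ^ p) := by
          rw [← ENNReal.ofReal_mul (by positivity), inv_mul_eq_div]
  calc ∫⁻ y : ℝ, ENNReal.ofReal (θ y)
      = ∫⁻ y in Iic 0 ∪ (Ioc 0 T ∪ Ioi T), ENNReal.ofReal (θ y) := by
        rw [Ioc_union_Ioi_eq_Ioi hT.le, Iic_union_Ioi, setLIntegral_univ]
    _ ≤ (∫⁻ y in Iic 0, ENNReal.ofReal (θ y)) +
          ∫⁻ y in Ioc 0 T ∪ Ioi T, ENNReal.ofReal (θ y) := lintegral_union_le _ _ _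
    _ ≤ 0 + (ENNReal.ofReal (c * T) + ENNReal.ofReal (K / T ^ p)) :=
        add_le_add hneg.le ((lintegral_union_le _ _ _).trans (add_le_add hmid htail))
    _ = ENNReal.ofReal (c * T + K / T ^ p) := by
        rw [zero_add, ← ENNReal.ofReal_add (by positivity) (by positivity)]

/-- Minorization of a Hölder-continuous density with a moment bound on a fixed
interval `[a, a + Δ]` within `(0, T_K]`. -/
theorem density_lower_bound_on_interval
    (K C m γ : ℝ) (hK : 0 < K) (hC : 0 < C) (hm : 0 < m)
    (hγ : γ ∈ Set.Ioc (0 : ℝ) 1)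
    (θ : ℝ → ℝ) (hcont : Continuous θ) (hnonneg : ∀ y, 0 ≤ θ y)
    (hdens : ∫⁻ y : ℝ, ENNReal.ofReal (θ y) = 1)
    (hvanish : ∀ x < (0 : ℝ), θ x = 0)
    (hhold : ∀ x y : ℝ, |θ x - θ y| ≤ C * |x - y| ^ γ)
    (hmom : ∫⁻ y in Set.Ioi (0 : ℝ), ENNReal.ofReal (y ^ (4 + m) * θ y)
        ≤ ENNReal.ofReal K)
    (TK Δ : ℝ) (hTK : TK = (2 * K) ^ ((4 + m)⁻¹)) (hΔ : Δ = (16 * TK * C) ^ (-γ⁻¹)) :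
    ∃ a ∈ Set.Ioc (0 : ℝ) TK, ∀ x ∈ Set.Icc a (a + Δ),
      (1 / 16) * (2 * K) ^ (-(4 + m)⁻¹) ≤ θ x := by
  obtain ⟨hγ0, -⟩ := hγ
  have hTpos : 0 < TK := hTK ▸ Real.rpow_pos_of_pos (by positivity) _
  have hTpow : TK ^ (4 + m) = 2 * K := by
    rw [hTK, Real.rpow_inv_rpow (by positivity) (by positivity)]
  have hTinv : (2 * K) ^ (-(4 + m)⁻¹) = TK⁻¹ := by
    rw [hTK, Real.rpow_neg (by positivity)]
  have hΔpow : C * Δ ^ γ = TK⁻¹ / 16 := by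
    rw [hΔ, ← Real.rpow_mul (by positivity), neg_mul, inv_mul_cancel₀ hγ0.ne',
      Real.rpow_neg_one]
    field_simp
  obtain ⟨a, ha, hθa⟩ : ∃ a ∈ Ioc 0 TK, TK⁻¹ / 8 ≤ θ a := by
    by_contra! h
    have key := lintegral_le_of_le_on_Ioc_of_moment hTpos (by positivity)
      (by positivity) hK.le hnonneg hvanish hmom fun y hy => (h y hy).le
    have hval : TK⁻¹ / 8 * TK + K / TK ^ (4 + m) = 5 / 8 := by
      rw [hTpow]
      field_simp
      norm_num
    rw [hdens, hval, ENNReal.one_le_ofReal] at key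
    norm_num at key
  refine ⟨a, ha, fun x hx => ?_⟩
  have hdist : C * |a - x| ^ γ ≤ TK⁻¹ / 16 := by
    rw [← hΔpow, abs_sub_comm, abs_of_nonneg (sub_nonneg.2 hx.1)]
    gcongr
    · exact sub_nonneg.2 hx.1
    · linarith [hx.2]
  have := (le_abs_self _).trans ((hhold a x).trans hdist)
  rw [hTinv]
  linarith
end
end

section
/- Let K, C, m, α > 0 and γ ∈ (0,1]. Let θ be a continuous probability density on ℝ vanishing on (−∞,0), satisfying ∫_0^∞ y^{4+m} θ(y) dy ≤ K and |θ(x) − θ(y)| ≤ C |x − y|^γ for all x, y. Set T_K = (2K)^{1/(4+m)}, Δ = (16 T_K C)^{−1/γ}, and let δ satisfy 1 < δ < min( e^α , (T_K + Δ)/T_K ). Define θ̌(v) = (1/(αv)) ∫_v^{v e^α} θ(x) dx for v > 0. Then there exists a ∈ (0, T_K] such that θ̌(v) ≥ (2K)^{−1/(4+m)} (δ − 1) / (16 α) for every v ∈ [a, (a + Δ)/δ]. -/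
open MeasureTheory Set
open scoped ENNReal Real

noncomputable section

/-- The density `θ̌` of `Y e^{-αU}` where `Y` has density `θ` and `U` is uniform on `[0,1]`. -/
def thetaCheck (α : ℝ) (θ : ℝ → ℝ) (v : ℝ) : ℝ :=
  (1 / (α * v)) * ∫ x in v..(v * Real.exp α), θ x

/-- A probability density on the half-line whose moment of order `p` is at most `K` is not small
everywhere on `(0, T]`, where `T ^ p = 2 * K`. -/
theorem exists_density_gt_of_moment_le {θ : ℝ → ℝ} {K T p : ℝ} (hK : 0 < K) (hT : 0 < T)
    (hp : 0 ≤ p) (hTp : T ^ p = 2 * K) (hnonneg : ∀ y, 0 ≤ θ y)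
    (hdens : ∫⁻ y : ℝ, ENNReal.ofReal (θ y) = 1) (hvanish : ∀ x < (0 : ℝ), θ x = 0)
    (hmom : ∫⁻ y in Set.Ioi (0 : ℝ), ENNReal.ofReal (y ^ p * θ y) ≤ ENNReal.ofReal K) :
    ∃ x ∈ Set.Ioc 0 T, 1 / (4 * T) < θ x := by
  by_contra! h
  have hleft : ∫⁻ y in Set.Iic (0 : ℝ), ENNReal.ofReal (θ y) = 0 := by
    rw [← setLIntegral_congr Iio_ae_eq_Iic]
    refine (setLIntegral_congr_fun measurableSet_Iio fun y hy => ?_).trans lintegral_zero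
    simp [hvanish y hy]
  have hmid : ∫⁻ y in Set.Ioc 0 T, ENNReal.ofReal (θ y) ≤ ENNReal.ofReal (1 / 4) := by
    calc ∫⁻ y in Set.Ioc 0 T, ENNReal.ofReal (θ y)
        ≤ ∫⁻ _ in Set.Ioc 0 T, ENNReal.ofReal (1 / (4 * T)) :=
          setLIntegral_mono measurable_const fun y hy => ENNReal.ofReal_le_ofReal (h y hy)
      _ = ENNReal.ofReal (1 / 4) := by
          rw [setLIntegral_const, Real.volume_Ioc, ← ENNReal.ofReal_mul (by positivity)]
          congr 1
          field_simp
          ring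
  have hright : ∫⁻ y in Set.Ioi T, ENNReal.ofReal (θ y) ≤ ENNReal.ofReal (1 / 2) := by
    calc ∫⁻ y in Set.Ioi T, ENNReal.ofReal (θ y)
        ≤ ∫⁻ y in Set.Ioi T, ENNReal.ofReal (1 / (2 * K)) * ENNReal.ofReal (y ^ p * θ y) := by
          refine setLIntegral_mono' measurableSet_Ioi fun y hy => ?_
          rw [← ENNReal.ofReal_mul (by positivity)]
          refine ENNReal.ofReal_le_ofReal ?_
          have hpow : 2 * K ≤ y ^ p := hTp ▸ Real.rpow_le_rpow hT.le (le_of_lt hy) hp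
          rw [one_div, le_inv_mul_iff₀ (by positivity)]
          exact mul_le_mul_of_nonneg_right hpow (hnonneg y)
      _ = ENNReal.ofReal (1 / (2 * K)) * ∫⁻ y in Set.Ioi T, ENNReal.ofReal (y ^ p * θ y) :=
          lintegral_const_mul' _ _ ENNReal.ofReal_ne_top
      _ ≤ ENNReal.ofReal (1 / (2 * K)) * ENNReal.ofReal K := by
          gcongr
          exact (lintegral_mono_set (Set.Ioi_subset_Ioi hT.le)).trans hmom
      _ = ENNReal.ofReal (1 / 2) := by
          rw [← ENNReal.ofReal_mul (by positivity)]
          congr 1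
          field_simp
  have htotal : (1 : ℝ≥0∞) ≤ ENNReal.ofReal (1 / 4 + 1 / 2) := by
    calc (1 : ℝ≥0∞) = ∫⁻ y in Set.Iic 0 ∪ (Set.Ioc 0 T ∪ Set.Ioi T), ENNReal.ofReal (θ y) := by
          rw [Set.Ioc_union_Ioi_eq_Ioi hT.le, Set.Iic_union_Ioi, setLIntegral_univ, hdens]
      _ ≤ 0 + (ENNReal.ofReal (1 / 4) + ENNReal.ofReal (1 / 2)) :=
          (lintegral_union_le _ _ _).trans <| add_le_add hleft.le <|
            (lintegral_union_le _ _ _).trans <| add_le_add hmid hright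
      _ = ENNReal.ofReal (1 / 4 + 1 / 2) := by
          rw [zero_add, ENNReal.ofReal_add (by norm_num) (by norm_num)]
  rw [ENNReal.one_le_ofReal] at htotal
  norm_num at htotal

/-- A lower bound for `θ` on `[v, δ * v]` gives a lower bound for `θ̌` at `v`. -/
theorem mul_div_le_thetaCheck {θ : ℝ → ℝ} {α δ c v : ℝ} (hα : 0 < α) (hv : 0 < v)
    (hδ : 1 ≤ δ) (hδα : δ ≤ Real.exp α) (hcont : Continuous θ) (hnonneg : ∀ y, 0 ≤ θ y)
    (hc : ∀ x ∈ Set.Icc v (δ * v), c ≤ θ x) :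
    c * (δ - 1) / α ≤ thetaCheck α θ v := by
  have hvδ : v ≤ δ * v := le_mul_of_one_le_left hv.le hδ
  have hint : c * (δ - 1) * v ≤ ∫ x in v..(v * Real.exp α), θ x := by
    calc c * (δ - 1) * v = ∫ _ in v..(δ * v), c := by
          rw [intervalIntegral.integral_const, smul_eq_mul]
          ring
      _ ≤ ∫ x in v..(δ * v), θ x :=
          intervalIntegral.integral_mono_on hvδ (by simp) (hcont.intervalIntegrable _ _) hc
      _ ≤ ∫ x in v..(v * Real.exp α), θ x :=
          intervalIntegral.integral_mono_interval le_rfl hvδ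
            (by rw [mul_comm v]; gcongr) (Filter.Eventually.of_forall hnonneg)
            (hcont.intervalIntegrable _ _)
  calc c * (δ - 1) / α = 1 / (α * v) * (c * (δ - 1) * v) := by field_simp
    _ ≤ thetaCheck α θ v := by
        unfold thetaCheck
        gcongr

/-- Minorization of `θ̌` on a fixed interval `[a, (a + Δ)/δ]`. -/
theorem thetaCheck_lower_bound_on_interval
    (K C m γ α δ : ℝ) (hK : 0 < K) (hC : 0 < C) (hm : 0 < m) (hα : 0 < α)
    (hγ : γ ∈ Set.Ioc (0 : ℝ) 1)
    (θ : ℝ → ℝ) (hcont : Continuous θ) (hnonneg : ∀ y, 0 ≤ θ y)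
    (hdens : ∫⁻ y : ℝ, ENNReal.ofReal (θ y) = 1)
    (hvanish : ∀ x < (0 : ℝ), θ x = 0)
    (hhold : ∀ x y : ℝ, |θ x - θ y| ≤ C * |x - y| ^ γ)
    (hmom : ∫⁻ y in Set.Ioi (0 : ℝ), ENNReal.ofReal (y ^ (4 + m) * θ y)
        ≤ ENNReal.ofReal K)
    (TK Δ : ℝ) (hTK : TK = (2 * K) ^ ((4 + m)⁻¹)) (hΔ : Δ = (16 * TK * C) ^ (-γ⁻¹))
    (hδ : 1 < δ ∧ δ < min (Real.exp α) ((TK + Δ) / TK)) :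
    ∃ a ∈ Set.Ioc (0 : ℝ) TK, ∀ v ∈ Set.Icc a ((a + Δ) / δ),
      (2 * K) ^ (-(4 + m)⁻¹) * (δ - 1) / (16 * α) ≤ thetaCheck α θ v := by
  obtain ⟨hδ1, hδ2⟩ := hδ
  have hTpos : 0 < TK := by rw [hTK]; positivity
  have hTp : TK ^ (4 + m) = 2 * K := by
    rw [hTK, Real.rpow_inv_rpow (by positivity) (by positivity)]
  have hinv : (2 * K) ^ (-(4 + m)⁻¹) = TK⁻¹ := by
    rw [hTK, Real.rpow_neg (by positivity)]
  have hΔγ : C * Δ ^ γ = 1 / (16 * TK) := by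
    rw [hΔ, ← Real.rpow_mul (by positivity), neg_mul, inv_mul_cancel₀ hγ.1.ne', Real.rpow_neg_one]
    field_simp
  obtain ⟨a, ha, hθa⟩ := exists_density_gt_of_moment_le hK hTpos (by positivity) hTp hnonneg hdens
    hvanish hmom
  refine ⟨a, ha, fun v hv => ?_⟩
  have hvpos : 0 < v := ha.1.trans_le hv.1
  have hlower : ∀ x ∈ Set.Icc v (δ * v), 1 / (16 * TK) ≤ θ x := by
    intro x hx
    have hvΔ : δ * v ≤ a + Δ := by
      rw [mul_comm]
      exact (le_div_iff₀ (by positivity)).1 hv.2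
    have hdist : |a - x| ≤ Δ := by
      rw [abs_le]
      constructor <;> linarith [hx.1, hx.2, hv.1]
    have hclose : θ a - θ x ≤ 1 / (16 * TK) :=
      calc θ a - θ x ≤ C * |a - x| ^ γ := (le_abs_self _).trans (hhold a x)
        _ ≤ C * Δ ^ γ := by
            gcongr
            exact hγ.1.le
        _ = 1 / (16 * TK) := hΔγ
    have hquarter : 1 / (4 * TK) = 4 * (1 / (16 * TK)) := by
      field_simp
      norm_num
    have hpos : 0 < 1 / (16 * TK) := by positivity
    linarith
  calc (2 * K) ^ (-(4 + m)⁻¹) * (δ - 1) / (16 * α) = 1 / (16 * TK) * (δ - 1) / α := by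
        rw [hinv]
        field_simp
    _ ≤ thetaCheck α θ v :=
        mul_div_le_thetaCheck hα hvpos hδ1.le (hδ2.le.trans (min_le_left _ _)) hcont hnonneg hlower
end
end

section
/- Let θ, θ̃ : ℝ → [0,∞) be measurable functions and let a < b, c < d and ε, ε̃ > 0 be such that θ(x) ≥ ε for all x ∈ [a,b] and θ̃(x) ≥ ε̃ for all x ∈ [c,d]. Then for every δ with 0 < δ < min(b − a, d − c) and every x ∈ [a + c + δ, b + d − δ], the convolution satisfies (θ ⋆ θ̃)(x) ≥ min(1, δ) · ε · ε̃. -/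
open MeasureTheory Set
open scoped ENNReal Real

noncomputable section

/-- Lower bound for the convolution of two nonnegative functions bounded below on intervals.
The convolution `(θ ⋆ θ̃)(x) = ∫ θ(x − y) θ̃(y) dy` is taken with values in `[0,∞]`. -/
theorem convolution_lower_bound
    (θ θt : ℝ → ℝ) (hθ : Measurable θ) (hθt : Measurable θt)
    (hθ0 : ∀ x, 0 ≤ θ x) (hθt0 : ∀ x, 0 ≤ θt x)
    (a b c d ε εt : ℝ) (hab : a < b) (hcd : c < d) (hε : 0 < ε) (hεt : 0 < εt)
    (hθlb : ∀ x ∈ Set.Icc a b, ε ≤ θ x)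
    (hθtlb : ∀ x ∈ Set.Icc c d, εt ≤ θt x)
    (δ : ℝ) (hδ : 0 < δ) (hδlt : δ < min (b - a) (d - c)) :
    ∀ x ∈ Set.Icc (a + c + δ) (b + d - δ),
      ENNReal.ofReal (min 1 δ * ε * εt)
        ≤ ∫⁻ y : ℝ, ENNReal.ofReal (θ (x - y)) * ENNReal.ofReal (θt y) := by
  rintro x ⟨hx₁, hx₂⟩
  obtain ⟨hδab, hδcd⟩ := lt_min_iff.mp hδlt
  set m := max c (x - b)
  have hcm : c ≤ m := le_max_left _ _
  have hbm : x - b ≤ m := le_max_right _ _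
  have hmd : m + δ ≤ d := by
    have : m ≤ d - δ := max_le (by linarith) (by linarith)
    linarith
  have hma : m + δ ≤ x - a := by
    have : m ≤ x - a - δ := max_le (by linarith) (by linarith)
    linarith
  calc ENNReal.ofReal (min 1 δ * ε * εt)
      ≤ ENNReal.ofReal (ε * εt * δ) := by
        apply ENNReal.ofReal_le_ofReal
        have := mul_le_mul_of_nonneg_left (min_le_right 1 δ) (mul_pos hε hεt).le
        linarith
    _ = ∫⁻ _ in Icc m (m + δ), ENNReal.ofReal ε * ENNReal.ofReal εt := by
        rw [setLIntegral_const, Real.volume_Icc, add_sub_cancel_left,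
          ENNReal.ofReal_mul (mul_pos hε hεt).le, ENNReal.ofReal_mul hε.le]
    _ ≤ ∫⁻ y in Icc m (m + δ), ENNReal.ofReal (θ (x - y)) * ENNReal.ofReal (θt y) := by
        refine setLIntegral_mono' measurableSet_Icc fun y ⟨hy₁, hy₂⟩ => ?_
        exact mul_le_mul'
          (ENNReal.ofReal_le_ofReal (hθlb _ ⟨by linarith, by linarith⟩))
          (ENNReal.ofReal_le_ofReal (hθtlb _ ⟨by linarith, by linarith⟩))
    _ ≤ ∫⁻ y, ENNReal.ofReal (θ (x - y)) * ENNReal.ofReal (θt y) :=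
        setLIntegral_le_lintegral _ _
end
end

section
/- Let θ : ℝ → [0,∞) be measurable, a < b and ε > 0 with θ(x) ≥ ε for all x ∈ [a,b]. Then for every integer n ≥ 1 and every x ∈ [na + (b−a)/2, nb − (b−a)/2], the n-fold convolution satisfies θ^{⋆n}(x) ≥ ( min(1, (b−a)/(2n)) )^{n−1} · ε^n. -/
open MeasureTheory Set
open scoped ENNReal Real

noncomputable section

/-- `convPowL f n` is the `(n+1)`-fold convolution power `f^{⋆(n+1)}` of the nonnegative
function `f`, with values in `[0,∞]`: `f^{⋆1} = f` and
`f^{⋆(n+1)}(x) = ∫ f^{⋆n}(x − y) f(y) dy`. -/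
def convPowL (f : ℝ → ℝ) : ℕ → ℝ → ℝ≥0∞
  | 0 => fun x => ENNReal.ofReal (f x)
  | n + 1 => fun x => ∫⁻ y : ℝ, convPowL f n (x - y) * ENNReal.ofReal (f y)

/-- If `f^{⋆(m+1)}(x - y) ≥ A` and `f(y) ≥ ε` for all `y` in an interval of length `d`, then
`f^{⋆(m+2)}(x) ≥ A * ε * d`. -/
lemma convPowL_succ_ge_of_interval {f : ℝ → ℝ} {m : ℕ} {A : ℝ≥0∞} {ε c d x : ℝ}
    (hf : ∀ y ∈ Icc c (c + d), ε ≤ f y)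
    (hA : ∀ y ∈ Icc c (c + d), A ≤ convPowL f m (x - y)) :
    A * ENNReal.ofReal ε * ENNReal.ofReal d ≤ convPowL f (m + 1) x := by
  calc A * ENNReal.ofReal ε * ENNReal.ofReal d
      = ∫⁻ _ in Icc c (c + d), A * ENNReal.ofReal ε := by
        rw [setLIntegral_const, Real.volume_Icc, add_sub_cancel_left]
    _ ≤ ∫⁻ y in Icc c (c + d), convPowL f m (x - y) * ENNReal.ofReal (f y) :=
        setLIntegral_mono' measurableSet_Icc fun y hy =>
          mul_le_mul' (hA y hy) (ENNReal.ofReal_le_ofReal (hf y hy))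
    _ ≤ convPowL f (m + 1) x := setLIntegral_le_lintegral _ _

/-- Lower bound for the `(m+1)`-fold convolution power on the `(m+1)`-fold dilate of the
interval `[a + d, b - d]`, for `d` at most a quarter of the length of `[a, b]`. -/
lemma convPowL_ge_of_mem_dilate {f : ℝ → ℝ} {a b ε d : ℝ} (hε : 0 ≤ ε) (hd : 0 ≤ d)
    (hdab : 4 * d ≤ b - a) (hf : ∀ x ∈ Icc a b, ε ≤ f x) (m : ℕ) :
    ∀ t ∈ Icc (a + d) (b - d),
      ENNReal.ofReal (d ^ m * ε ^ (m + 1)) ≤ convPowL f m ((m + 1) * t) := by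
  induction m with
  | zero =>
    rintro t ⟨hat, htb⟩
    simpa [convPowL] using ENNReal.ofReal_le_ofReal (hf t ⟨by linarith, by linarith⟩)
  | succ m ih =>
    rintro t ⟨hat, htb⟩
    have hm : (0 : ℝ) < m + 1 := by positivity
    have hconst : ENNReal.ofReal (d ^ (m + 1) * ε ^ (m + 1 + 1)) =
        ENNReal.ofReal (d ^ m * ε ^ (m + 1)) * ENNReal.ofReal ε * ENNReal.ofReal d := by
      rw [← ENNReal.ofReal_mul (by positivity), ← ENNReal.ofReal_mul (by positivity)]
      ring_nf
    have hconv (y : ℝ) (hy : t + (t - y) / (m + 1) ∈ Icc (a + d) (b - d)) :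
        ENNReal.ofReal (d ^ m * ε ^ (m + 1)) ≤
          convPowL f m (((m + 1 : ℕ) + 1) * t - y) := by
      convert ih _ hy using 2
      push_cast
      field_simp
      ring
    rw [hconst]
    have hm1 : (1 : ℝ) ≤ m + 1 := by linarith [(Nat.cast_nonneg m : (0 : ℝ) ≤ m)]
    rcases le_total t ((a + b) / 2) with h | h
    · refine convPowL_succ_ge_of_interval (c := t - d)
        (fun y hy => hf y ⟨by linarith [hy.1], by linarith [hy.2]⟩) fun y hy => hconv y ?_
      have h0 : 0 ≤ (t - y) / (m + 1) := div_nonneg (by linarith [hy.2]) hm.le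
      have h1 : (t - y) / (m + 1) ≤ t - y := div_le_self (by linarith [hy.2]) hm1
      exact ⟨by linarith, by linarith [hy.1]⟩
    · refine convPowL_succ_ge_of_interval (c := t)
        (fun y hy => hf y ⟨by linarith [hy.1], by linarith [hy.2]⟩) fun y hy => hconv y ?_
      have h0 : 0 ≤ (y - t) / (m + 1) := div_nonneg (by linarith [hy.1]) hm.le
      have h1 : (y - t) / (m + 1) ≤ y - t := div_le_self (by linarith [hy.1]) hm1
      have h2 : (t - y) / (m + 1) = -((y - t) / (m + 1)) := by ring
      exact ⟨by linarith [hy.2], by linarith⟩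

/-- Lower bound for `n`-fold convolution powers of a nonnegative function bounded below
on an interval. -/
theorem convPow_lower_bound
    (θ : ℝ → ℝ) (hθ : Measurable θ) (hθ0 : ∀ x, 0 ≤ θ x)
    (a b ε : ℝ) (hab : a < b) (hε : 0 < ε)
    (hθlb : ∀ x ∈ Set.Icc a b, ε ≤ θ x) :
    ∀ n : ℕ, 1 ≤ n →
      ∀ x ∈ Set.Icc (n * a + (b - a) / 2) (n * b - (b - a) / 2),
        ENNReal.ofReal ((min 1 ((b - a) / (2 * n))) ^ (n - 1) * ε ^ n)
          ≤ convPowL θ (n - 1) x := by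
  rintro n hn x ⟨hax, hxb⟩
  obtain ⟨m, rfl⟩ : ∃ m, n = m + 1 := ⟨n - 1, by omega⟩
  rw [Nat.add_sub_cancel]
  rcases Nat.eq_zero_or_pos m with rfl | hm
  · simp only [zero_add, Nat.cast_one, one_mul] at hax hxb
    simpa [convPowL] using
      ENNReal.ofReal_le_ofReal (hθlb x ⟨by linarith, by linarith⟩)
  have hm1 : (1 : ℝ) ≤ m := by exact_mod_cast hm
  push_cast at hax hxb ⊢
  set d := (b - a) / (2 * ((m : ℝ) + 1)) with hd_def
  have hd : 0 < d := div_pos (by linarith) (by linarith)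
  have hdm : (m + 1) * d = (b - a) / 2 := by rw [hd_def]; field_simp
  have hdab : 4 * d ≤ b - a := by nlinarith
  have hx : (m + 1) * (x / (m + 1)) = x := by field_simp
  have ht : x / (m + 1) ∈ Icc (a + d) (b - d) := by
    rw [mem_Icc, le_div_iff₀ (by linarith), div_le_iff₀ (by linarith)]
    exact ⟨by linarith, by linarith⟩
  have key := convPowL_ge_of_mem_dilate hε.le hd.le hdab hθlb m _ ht
  rw [hx] at key
  refine le_trans (ENNReal.ofReal_le_ofReal ?_) key
  gcongr
  exact min_le_right _ _
end
end

section
/- Let α > 0 and u ∈ ℝ. Then the improper integral ∫_0^∞ ( e^{i u e^{−αv}} − 1 ) dv converges and equals (1/α) ∫_0^u (e^{is} − 1)/s ds, where the integrand s ↦ (e^{is} − 1)/s is extended by the value i at s = 0. -/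
open MeasureTheory Set intervalIntegral
open scoped ENNReal Real

noncomputable section

/-- The integrand `s ↦ (e^{is} − 1)/s`, extended by the value `i` at `s = 0`. -/
def sinc1 (s : ℝ) : ℂ :=
  if s = 0 then Complex.I else (Complex.exp (Complex.I * s) - 1) / s

lemma sinc1_mul_self (s : ℝ) : (s : ℂ) * sinc1 s = Complex.exp (Complex.I * s) - 1 := by
  by_cases h : s = 0
  · simp [h]
  · have : (s : ℂ) ≠ 0 := by exact_mod_cast h
    rw [sinc1, if_neg h, ← mul_div_assoc, mul_div_cancel_left₀ _ this]

lemma continuous_sinc1 : Continuous sinc1 := by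
  have hd : ∀ x : ℝ, HasDerivAt (fun s : ℝ => Complex.exp (Complex.I * s))
      (Complex.exp (Complex.I * x) * Complex.I) x := fun x => by
    simpa using ((hasDerivAt_id x).ofReal_comp.const_mul Complex.I).cexp
  have heq : sinc1 = dslope (fun s : ℝ => Complex.exp (Complex.I * s)) 0 := by
    funext s
    by_cases h : s = 0
    · subst h
      rw [dslope_same, (hd 0).deriv]
      simp [sinc1]
    · rw [dslope_of_ne _ h, slope_def_module]
      simp [sinc1, h, div_eq_inv_mul]
  rw [heq, continuous_iff_continuousAt]
  intro x
  by_cases h : x = 0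
  · subst h
    exact continuousAt_dslope_same.2 (hd 0).differentiableAt
  · exact (continuousAt_dslope_of_ne h).2 (hd x).continuousAt

lemma hasDerivAt_integral_sinc1_exp (α u v : ℝ) (hα : α ≠ 0) :
    HasDerivAt (fun v : ℝ => -(1 / α : ℂ) * ∫ s in (0 : ℝ)..(u * Real.exp (-α * v)), sinc1 s)
      (Complex.exp (Complex.I * u * Real.exp (-α * v)) - 1) v := by
  have hw : HasDerivAt (fun v : ℝ => u * Real.exp (-α * v))
      (u * (Real.exp (-α * v) * (-α))) v := by
    simpa using (((hasDerivAt_id v).const_mul (-α)).exp).const_mul u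
  have hG := continuous_sinc1.integral_hasStrictDerivAt 0 (u * Real.exp (-α * v))
  refine ((hG.hasDerivAt.scomp v hw).const_mul (-(1 / α : ℂ))).congr_deriv ?_
  have hc : (α : ℂ) ≠ 0 := by exact_mod_cast hα
  have hs := sinc1_mul_self (u * Real.exp (-α * v))
  rw [Complex.ofReal_mul, ← mul_assoc] at hs
  rw [← hs, Complex.real_smul]
  push_cast
  field_simp

lemma integrableOn_exp_shotnoise_kernel (α : ℝ) (hα : 0 < α) (u : ℝ) :
    IntegrableOn (fun v : ℝ => Complex.exp (Complex.I * u * Real.exp (-α * v)) - 1)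
      (Set.Ioi (0 : ℝ)) volume := by
  refine ((exp_neg_integrableOn_Ioi 0 hα).const_mul |u|).mono'
    (Continuous.aestronglyMeasurable (by fun_prop)) (Filter.Eventually.of_forall fun v => ?_)
  have h := Real.norm_exp_I_mul_ofReal_sub_one_le (x := u * Real.exp (-α * v))
  rwa [Complex.ofReal_mul, ← mul_assoc, norm_mul, Real.norm_eq_abs, Real.norm_eq_abs,
    Real.abs_exp] at h

/-- For the exponential impulse response `h(v) = e^{-αv}`, the kernel
`∫_0^∞ (e^{iu e^{-αv}} − 1) dv` converges and equals `(1/α) ∫_0^u (e^{is} − 1)/s ds`. -/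
theorem exponential_shotnoise_kernel (α : ℝ) (hα : 0 < α) (u : ℝ) :
    IntegrableOn (fun v : ℝ => Complex.exp (Complex.I * u * Real.exp (-α * v)) - 1)
        (Set.Ioi (0 : ℝ)) volume ∧
      (∫ v in Set.Ioi (0 : ℝ), (Complex.exp (Complex.I * u * Real.exp (-α * v)) - 1))
        = (1 / α : ℂ) * ∫ s in (0 : ℝ)..u, sinc1 s := by
  refine ⟨integrableOn_exp_shotnoise_kernel α hα u, ?_⟩
  have hlim : Filter.Tendsto (fun v : ℝ => u * Real.exp (-α * v)) Filter.atTop (nhds 0) := by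
    have h : Filter.Tendsto (fun v : ℝ => -α * v) Filter.atTop Filter.atBot :=
      Filter.tendsto_id.const_mul_atTop_of_neg (neg_lt_zero.2 hα)
    simpa using (Real.tendsto_exp_atBot.comp h).const_mul u
  have hG : Filter.Tendsto (fun x : ℝ => ∫ s in (0 : ℝ)..x, sinc1 s) (nhds 0) (nhds 0) := by
    simpa using
      (continuous_sinc1.integral_hasStrictDerivAt 0 0).hasDerivAt.continuousAt.tendsto
  have hF := (hG.comp hlim).const_mul (-(1 / α : ℂ))
  rw [integral_Ioi_of_hasDerivAt_of_tendsto'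
    (fun v _ => hasDerivAt_integral_sinc1_exp α u v hα.ne')
    (integrableOn_exp_shotnoise_kernel α hα u) hF]
  simp
end
end

section
/- Let α, λ > 0 and let θ be a probability density on ℝ with ∫_ℝ |y| θ(y) dy < ∞. Define K_α(x) = ∫_0^x (e^{is} − 1)/(αs) ds (integrand extended by i/α at s = 0), φ(u) = exp( λ ∫_ℝ K_α(uy) θ(y) dy ), and φ_Y(u) = ∫_ℝ e^{iuy} θ(y) dy. Then φ is differentiable on ℝ and for every u ≠ 0, φ'(u) = φ(u) · (λ/(αu)) · ( φ_Y(u) − 1 ). -/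
open MeasureTheory Set
open scoped ENNReal Real

noncomputable section

/-- The kernel `K_α(x) = ∫_0^x (e^{is} − 1)/(αs) ds`, integrand extended by `i/α` at `s = 0`. -/
def Kalpha (α : ℝ) (x : ℝ) : ℂ :=
  ∫ s in (0 : ℝ)..x,
    (if s = 0 then Complex.I / α else (Complex.exp (Complex.I * s) - 1) / (α * s))

/-- Characteristic function of the stationary exponential shot noise. -/
def shotCF (α lam : ℝ) (θ : ℝ → ℝ) (u : ℝ) : ℂ :=
  Complex.exp ((lam : ℂ) * ∫ y : ℝ, (θ y : ℂ) * Kalpha α (u * y))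

/-- Characteristic function of the marks, with density `θ`. -/
def markCF (θ : ℝ → ℝ) (u : ℝ) : ℂ :=
  ∫ y : ℝ, (θ y : ℂ) * Complex.exp (Complex.I * u * y)

/-- The integrand of `Kalpha`, extended by continuity at `0`. -/
def kernelIntegrand (α s : ℝ) : ℂ :=
  if s = 0 then Complex.I / α else (Complex.exp (Complex.I * s) - 1) / (α * s)

lemma kernelIntegrand_eq_dslope (α : ℝ) :
    kernelIntegrand α =
      fun s => dslope (fun t : ℝ => Complex.exp (Complex.I * t)) 0 s / α := by
  have hd : HasDerivAt (fun t : ℝ => Complex.exp (Complex.I * t)) Complex.I 0 := by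
    have h := ((Complex.ofRealCLM.hasDerivAt (x := (0 : ℝ))).const_mul Complex.I).cexp
    simpa using h
  funext s
  rcases eq_or_ne s 0 with rfl | hs
  · simp [kernelIntegrand, hd.deriv]
  · rw [dslope_of_ne _ hs]
    simp only [kernelIntegrand, if_neg hs, slope_def_module, Complex.real_smul]
    simp only [sub_zero, Complex.ofReal_inv, Complex.ofReal_zero, mul_zero, Complex.exp_zero]
    ring

lemma continuous_kernelIntegrand (α : ℝ) : Continuous (kernelIntegrand α) := by
  rw [kernelIntegrand_eq_dslope]
  refine Continuous.div_const ?_ _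
  have hd : Differentiable ℝ (fun t : ℝ => Complex.exp (Complex.I * t)) := by fun_prop
  rw [continuous_iff_continuousAt]
  intro s
  rcases eq_or_ne s 0 with rfl | hs
  · exact continuousAt_dslope_same.2 (hd 0)
  · exact (continuousAt_dslope_of_ne hs).2 hd.continuous.continuousAt

lemma norm_kernelIntegrand_le {α : ℝ} (hα : 0 < α) (s : ℝ) :
    ‖kernelIntegrand α s‖ ≤ 1 / α := by
  unfold kernelIntegrand
  split_ifs with hs
  · simp [abs_of_pos hα]
  · have h : ‖Complex.exp (Complex.I * s) - 1‖ ≤ ‖s‖ := Real.norm_exp_I_mul_ofReal_sub_one_le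
    have hs' : 0 < |s| := abs_pos.2 hs
    rw [norm_div, norm_mul, Complex.norm_real, Complex.norm_real, Real.norm_eq_abs,
      Real.norm_eq_abs, abs_of_pos hα, div_le_div_iff₀ (by positivity) hα]
    rw [Real.norm_eq_abs] at h
    nlinarith

lemma hasDerivAt_Kalpha (α x : ℝ) : HasDerivAt (Kalpha α) (kernelIntegrand α x) x :=
  (continuous_kernelIntegrand α).integral_hasStrictDerivAt 0 x |>.hasDerivAt

lemma continuous_Kalpha (α : ℝ) : Continuous (Kalpha α) :=
  continuous_iff_continuousAt.2 fun x => (hasDerivAt_Kalpha α x).continuousAt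

lemma norm_Kalpha_le {α : ℝ} (hα : 0 < α) (x : ℝ) : ‖Kalpha α x‖ ≤ 1 / α * |x| := by
  simpa [Kalpha, kernelIntegrand] using
    intervalIntegral.norm_integral_le_of_norm_le_const (a := 0) (b := x)
      (f := kernelIntegrand α) fun s _ => norm_kernelIntegrand_le hα s

lemma mul_kernelIntegrand (α : ℝ) {u : ℝ} (hu : u ≠ 0) (y : ℝ) :
    (y : ℂ) * kernelIntegrand α (u * y) =
      ((1 / (α * u) : ℝ) : ℂ) * (Complex.exp (Complex.I * u * y) - 1) := by
  rcases eq_or_ne y 0 with rfl | hy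
  · simp
  · have hu' : (u : ℂ) ≠ 0 := by exact_mod_cast hu
    have hy' : (y : ℂ) ≠ 0 := by exact_mod_cast hy
    rw [kernelIntegrand, if_neg (mul_ne_zero hu hy)]
    push_cast
    rw [← mul_assoc Complex.I]
    field_simp

/-- Differentiation under the integral sign in the exponent of `shotCF`. -/
lemma hasDerivAt_integral_mul_Kalpha {α : ℝ} (hα : 0 < α) {θ : ℝ → ℝ} (hmeas : Measurable θ)
    (hmom : Integrable fun y => |y| * θ y) (u : ℝ) :
    HasDerivAt (fun v : ℝ => ∫ y : ℝ, (θ y : ℂ) * Kalpha α (v * y))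
      (∫ y : ℝ, (θ y : ℂ) * (y * kernelIntegrand α (u * y))) u := by
  have hK (v : ℝ) : AEStronglyMeasurable (fun y : ℝ => (θ y : ℂ) * Kalpha α (v * y)) :=
    ((Complex.measurable_ofReal.comp hmeas).mul
      ((continuous_Kalpha α).measurable.comp (measurable_const_mul v))).aestronglyMeasurable
  refine (hasDerivAt_integral_of_dominated_loc_of_deriv_le
    (bound := fun y => 1 / α * ‖|y| * θ y‖) (s := univ)
    (F' := fun v y => (θ y : ℂ) * (y * kernelIntegrand α (v * y)))
    Filter.univ_mem (.of_forall hK) ?_ ?_ ?_ ?_ ?_).2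
  · refine (hmom.norm.const_mul (1 / α * |u|)).mono' (hK u) (.of_forall fun y => ?_)
    have h := mul_le_mul_of_nonneg_left (norm_Kalpha_le hα (u * y)) (abs_nonneg (θ y))
    rw [norm_mul, Complex.norm_real, Real.norm_eq_abs, norm_mul, Real.norm_eq_abs,
      Real.norm_eq_abs, abs_abs]
    rw [abs_mul] at h
    linarith
  · exact ((Complex.measurable_ofReal.comp hmeas).mul (Complex.measurable_ofReal.mul
      ((continuous_kernelIntegrand α).measurable.comp
        (measurable_const_mul u)))).aestronglyMeasurable
  · refine .of_forall fun y v _ => ?_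
    have h := mul_le_mul_of_nonneg_left (norm_kernelIntegrand_le hα (v * y))
      (mul_nonneg (abs_nonneg (θ y)) (abs_nonneg y))
    rw [norm_mul, norm_mul, Complex.norm_real, Complex.norm_real, norm_mul]
    simp only [Real.norm_eq_abs, abs_abs]
    linarith
  · exact hmom.norm.const_mul _
  · refine .of_forall fun y v _ => HasDerivAt.const_mul _ ?_
    simpa [Function.comp_def] using
      (hasDerivAt_Kalpha α (v * y)).scomp v ((hasDerivAt_id v).mul_const y)

lemma integral_mul_kernelIntegrand (α : ℝ) {θ : ℝ → ℝ} (hint : Integrable θ)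
    (hone : ∫ y, θ y = 1) {u : ℝ} (hu : u ≠ 0) :
    ∫ y : ℝ, (θ y : ℂ) * (y * kernelIntegrand α (u * y)) =
      ((1 / (α * u) : ℝ) : ℂ) * (markCF θ u - 1) := by
  have hθ : Integrable fun y => (θ y : ℂ) := hint.ofReal
  have hexp : Integrable fun y : ℝ => (θ y : ℂ) * Complex.exp (Complex.I * u * y) := by
    refine hθ.mul_bdd (c := 1) (by fun_prop) (.of_forall fun y => ?_)
    rw [mul_assoc, ← Complex.ofReal_mul, Complex.norm_exp_I_mul_ofReal]
  have hone' : ∫ y, (θ y : ℂ) = 1 := by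
    rw [integral_complex_ofReal, hone, Complex.ofReal_one]
  rw [markCF, ← hone', ← integral_sub hexp hθ, ← integral_const_mul]
  congr 1 with y
  rw [mul_kernelIntegrand α hu]
  ring

/-- The characteristic function `φ` of the exponential shot noise is differentiable and
satisfies `φ'(u) = φ(u) (λ/(αu)) (φ_Y(u) − 1)` for `u ≠ 0`. -/
theorem shotCF_deriv (α lam : ℝ) (hα : 0 < α) (hlam : 0 < lam)
    (θ : ℝ → ℝ) (hmeas : Measurable θ) (hnonneg : ∀ y, 0 ≤ θ y)
    (hdens : ∫⁻ y : ℝ, ENNReal.ofReal (θ y) = 1)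
    (hmom : ∫⁻ y : ℝ, ENNReal.ofReal (|y| * θ y) < ⊤) :
    (∀ u : ℝ, DifferentiableAt ℝ (shotCF α lam θ) u) ∧
      ∀ u : ℝ, u ≠ 0 →
        deriv (shotCF α lam θ) u
          = shotCF α lam θ u * ((lam / (α * u) : ℝ) : ℂ) * (markCF θ u - 1) := by
  have hint : Integrable θ := by
    refine ⟨hmeas.aestronglyMeasurable, ?_⟩
    rw [hasFiniteIntegral_iff_ofReal (.of_forall hnonneg), hdens]
    exact ENNReal.one_lt_top
  have hone : ∫ y, θ y = 1 := by
    rw [integral_eq_lintegral_of_nonneg_ae (.of_forall hnonneg) hmeas.aestronglyMeasurable,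
      hdens, ENNReal.toReal_one]
  have hmom' : Integrable fun y => |y| * θ y :=
    ⟨(by fun_prop : Measurable fun y => |y| * θ y).aestronglyMeasurable,
      (hasFiniteIntegral_iff_ofReal
        (.of_forall fun y => mul_nonneg (abs_nonneg y) (hnonneg y))).2 hmom⟩
  have hderiv (u : ℝ) := ((hasDerivAt_integral_mul_Kalpha hα hmeas hmom' u).const_mul
    (lam : ℂ)).cexp
  refine ⟨fun u => (hderiv u).differentiableAt, fun u hu => ?_⟩
  refine (hderiv u).deriv.trans ?_
  rw [integral_mul_kernelIntegrand α hint hone hu, shotCF]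
  push_cast
  ring
end
end
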